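/- arXiv:0810.4377 — 2 statements merged into one kernel-verified Lean document; each statement's English description precedes it below -/
import Mathlib

section
/- Let V be an ℓ-Volterra QSO with associated coefficients a_{ki}. Suppose there exist k₀ ∈ {1,...,ℓ} and δ > 0 such that a_{k₀ i} ≤ −δ for every i ∈ E. Then for every x^0 ∈ S^{m-1}, along the trajectory x^{(n+1)} = V(x^{(n)}) one has x_{k₀}^{(n)} ≤ (1−δ)^n x_{k₀}^{(0)} → 0, and hence every ω-limit point x* of the trajectory satisfies ∏_{i=1}^ℓ x*_i = 0, i.e. ω(x^0) ⊂ {x ∈ S^{m-1} : ∏_{i=1}^ℓ x_i = 0}. -/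
open Finset Filter Topology

/-- The quadratic stochastic operator determined by the cubic matrix `P`. -/
def QSOmap (m : ℕ) (P : Fin m → Fin m → Fin m → ℝ) (x : Fin m → ℝ) : Fin m → ℝ :=
  fun k => ∑ i, ∑ j, P i j k * x i * x j

/-- Conditions on the heredity coefficients of a quadratic stochastic operator. -/
def IsQSO (m : ℕ) (P : Fin m → Fin m → Fin m → ℝ) : Prop :=
  (∀ i j k, 0 ≤ P i j k) ∧ (∀ i j k, P i j k = P j i k) ∧ (∀ i j, ∑ k, P i j k = 1)

/-- Membership in the simplex `S^{m-1}`. -/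
def InSimplex (m : ℕ) (x : Fin m → ℝ) : Prop :=
  (∀ i, 0 ≤ x i) ∧ ∑ i, x i = 1

/-- Membership in the interior of the simplex `S^{m-1}`. -/
def InIntSimplex (m : ℕ) (x : Fin m → ℝ) : Prop :=
  (∀ i, 0 < x i) ∧ ∑ i, x i = 1

/-- The coefficients `P` define an `ℓ`-Volterra QSO (indices `0,...,ℓ-1` play the
role of `1,...,ℓ`). -/
def IsLVolterra (m ℓ : ℕ) (P : Fin m → Fin m → Fin m → ℝ) : Prop :=
  IsQSO m P ∧
  (∀ i j k : Fin m, (k : ℕ) < ℓ → k ≠ i → k ≠ j → P i j k = 0) ∧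
  (∀ k : Fin m, ℓ ≤ (k : ℕ) → ∃ i j : Fin m, i ≠ k ∧ j ≠ k ∧ 0 < P i j k)

/-- The numbers `a_{ki}`: `a_{ki} = 2 P_{ik,k} - 1` for `i ≠ k` and `a_{kk} = P_{kk,k} - 1`. -/
def aCoef (m : ℕ) (P : Fin m → Fin m → Fin m → ℝ) (k i : Fin m) : ℝ :=
  if i = k then P k k k - 1 else 2 * P i k k - 1

theorem simplex_step (m : ℕ) (P : Fin m → Fin m → Fin m → ℝ) (hP : IsQSO m P)
    (x : Fin m → ℝ) (hx : InSimplex m x) : InSimplex m (QSOmap m P x) := by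
  obtain ⟨h1, h2, h3⟩ := hP
  obtain ⟨hx1, hx2⟩ := hx
  refine ⟨fun k => ?_, ?_⟩
  · exact Finset.sum_nonneg fun i _ => Finset.sum_nonneg fun j _ =>
      mul_nonneg (mul_nonneg (h1 i j k) (hx1 i)) (hx1 j)
  · unfold QSOmap
    rw [Finset.sum_comm]
    have : ∀ i, ∑ k, ∑ j, P i j k * x i * x j = x i := by
      intro i
      rw [Finset.sum_comm]
      have : ∀ j, ∑ k, P i j k * x i * x j = x i * x j := by
        intro j
        rw [← Finset.sum_mul, ← Finset.sum_mul, h3, one_mul]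
      simp only [this]
      rw [← Finset.mul_sum, hx2, mul_one]
    simp only [this, hx2]

theorem contraction_step (m : ℕ) (P : Fin m → Fin m → Fin m → ℝ) (k : Fin m) (c : ℝ)
    (hP : ∀ i j, P i j k ≤ c / 2 * ((if i = k then 1 else 0) + (if j = k then 1 else 0)))
    (x : Fin m → ℝ) (hx : InSimplex m x) : QSOmap m P x k ≤ c * x k := by
  obtain ⟨hx1, hx2⟩ := hx
  calc QSOmap m P x k
      ≤ ∑ i, ∑ j, (c / 2 * ((if i = k then 1 else 0) + (if j = k then 1 else 0))) * x i * x j := by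
        refine Finset.sum_le_sum fun i _ => Finset.sum_le_sum fun j _ => ?_
        exact mul_le_mul_of_nonneg_right (mul_le_mul_of_nonneg_right (hP i j) (hx1 i)) (hx1 j)
    _ = ∑ i, ((c / 2 * (if i = k then x i else 0)) + c / 2 * x i * x k) := by
        refine Finset.sum_congr rfl fun i _ => ?_
        have : ∀ j, (c / 2 * ((if i = k then 1 else 0) + (if j = k then 1 else 0))) * x i * x j
            = c / 2 * (if i = k then x i else 0) * x j
              + c / 2 * x i * (if j = k then x j else 0) := by
          intro j
          split_ifs <;> ring
        simp only [this, Finset.sum_add_distrib, ← Finset.mul_sum, hx2]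
        simp
    _ = c * x k := by
        rw [Finset.sum_add_distrib, ← Finset.mul_sum, ← Finset.sum_mul, ← Finset.mul_sum, hx2]
        simp
        ring

/-- Theorem 5: if `a_{k₀ i} ≤ -δ` for all `i`, then
`x_{k₀}^{(n)} ≤ (1 - δ)^n x_{k₀}^{(0)} → 0` and every ω-limit point lies in
`{x : ∏_{i=1}^ℓ x_i = 0}`. -/
theorem omega_limit_boundary (m ℓ : ℕ) (hℓ1 : 1 ≤ ℓ) (hℓm : ℓ ≤ m)
    (P : Fin m → Fin m → Fin m → ℝ) (hV : IsLVolterra m ℓ P)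
    (k₀ : Fin m) (hk₀ : (k₀ : ℕ) < ℓ) (δ : ℝ) (hδ : 0 < δ)
    (ha : ∀ i : Fin m, aCoef m P k₀ i ≤ -δ)
    (x0 : Fin m → ℝ) (hx0 : InSimplex m x0)
    (traj : ℕ → (Fin m → ℝ)) (h0 : traj 0 = x0)
    (hstep : ∀ n, traj (n + 1) = QSOmap m P (traj n)) :
    (∀ n, traj n k₀ ≤ (1 - δ) ^ n * x0 k₀) ∧
    Tendsto (fun n => traj n k₀) atTop (𝓝 0) ∧
    ∀ xstar : Fin m → ℝ,
      (∃ φ : ℕ → ℕ, StrictMono φ ∧ Tendsto (fun n => traj (φ n)) atTop (𝓝 xstar)) →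
      ∏ i ∈ Finset.univ.filter (fun i : Fin m => (i : ℕ) < ℓ), xstar i = 0 := by
  obtain ⟨hQ, hvol, -⟩ := hV
  have hS : ∀ n, InSimplex m (traj n) := by
    intro n
    induction n with
    | zero => rw [h0]; exact hx0
    | succ n ih => rw [hstep]; exact simplex_step m P hQ _ ih
  have hkk : P k₀ k₀ k₀ ≤ 1 - δ := by
    have := ha k₀
    simp only [aCoef, if_true] at this
    linarith
  have hc : 0 ≤ 1 - δ := (hQ.1 k₀ k₀ k₀).trans hkk
  have hik : ∀ i, i ≠ k₀ → P i k₀ k₀ ≤ (1 - δ) / 2 := by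
    intro i hi
    have := ha i
    simp only [aCoef, if_neg hi] at this
    linarith
  have hP : ∀ i j, P i j k₀ ≤
      (1 - δ) / 2 * ((if i = k₀ then 1 else 0) + (if j = k₀ then 1 else 0)) := by
    intro i j
    by_cases hi : i = k₀
    · by_cases hj : j = k₀
      · subst hi; subst hj; simp; linarith
      · have := hik j hj
        rw [hQ.2.1] at this
        subst hi
        simp [hj]; linarith
    · by_cases hj : j = k₀
      · have := hik i hi
        subst hj
        simp [hi]; linarith
      · simp [hi, hj, hvol i j k₀ hk₀ (Ne.symm hi) (Ne.symm hj)]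
  have hb : ∀ n, traj n k₀ ≤ (1 - δ) ^ n * x0 k₀ := by
    intro n
    induction n with
    | zero => simp [h0]
    | succ n ih =>
      rw [hstep]
      calc _ ≤ (1 - δ) * traj n k₀ := contraction_step m P k₀ _ hP _ (hS n)
        _ ≤ (1 - δ) * ((1 - δ) ^ n * x0 k₀) := mul_le_mul_of_nonneg_left ih hc
        _ = _ := by ring
  have hT : Tendsto (fun n => traj n k₀) atTop (𝓝 0) := by
    refine squeeze_zero (fun n => (hS n).1 k₀) hb ?_
    simpa using (tendsto_pow_atTop_nhds_zero_of_lt_one hc (by linarith)).mul_const (x0 k₀)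
  refine ⟨hb, hT, ?_⟩
  rintro xstar ⟨φ, hφ, hlim⟩
  refine Finset.prod_eq_zero (i := k₀) (by simp [hk₀]) ?_
  exact tendsto_nhds_unique ((tendsto_pi_nhds.1 hlim) k₀) (hT.comp hφ.tendsto_atTop)
end

section
/- Let V be an ℓ-Volterra QSO with associated coefficients a_{ki}, let r ≤ ℓ, and suppose a_{ki} < 0 for all k ∈ {1,...,r} and i ∈ {r+1,...,m}. Then for any trajectory x^{(n+1)} = V(x^{(n)}) with x^{(0)} ∈ int S^{m-1} and for each i ∈ {1,...,r}, the coordinate x_i^{(n)} converges to 0 at the rate of a geometric progression: x_i^{(n)} ≤ C q^n for some C > 0 and 0 < q < 1 (one may take q = 1 − α + α φ(x^{(0)}) where α = min{−a_{ki} : k ≤ r, i ≥ r+1} and φ(x) = x_1 + ⋯ + x_r). -/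
open Finset Filter Topology

/-- `φ(x) = x_1 + ⋯ + x_r` (sum of the first `r` coordinates). -/
def phiSum (m r : ℕ) (x : Fin m → ℝ) : ℝ :=
  ∑ k ∈ Finset.univ.filter (fun k : Fin m => (k : ℕ) < r), x k

lemma qso_simplex {m : ℕ} {P : Fin m → Fin m → Fin m → ℝ} (hP : IsQSO m P)
    {x : Fin m → ℝ} (hx : InSimplex m x) : InSimplex m (QSOmap m P x) := by
  obtain ⟨h1, h2, h3⟩ := hP
  obtain ⟨hx0, hx1⟩ := hx
  refine ⟨fun k => ?_, ?_⟩
  · exact Finset.sum_nonneg fun i _ => Finset.sum_nonneg fun j _ =>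
      mul_nonneg (mul_nonneg (h1 i j k) (hx0 i)) (hx0 j)
  · unfold QSOmap
    rw [Finset.sum_comm]
    have : ∀ i, ∑ k, ∑ j, P i j k * x i * x j = x i := by
      intro i
      rw [Finset.sum_comm]
      have : ∀ j, ∑ k, P i j k * x i * x j = x i * x j := by
        intro j
        rw [← Finset.sum_mul, ← Finset.sum_mul, h3, one_mul]
      simp only [this]
      rw [← Finset.mul_sum, hx1, mul_one]
    simp only [this]
    exact hx1

lemma coef_bound {m ℓ r : ℕ} (hrℓ : r ≤ ℓ)
    {P : Fin m → Fin m → Fin m → ℝ} (hV : IsLVolterra m ℓ P) {α : ℝ}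
    (hαmin : ∀ k i : Fin m, (k : ℕ) < r → r ≤ (i : ℕ) → α ≤ -aCoef m P k i)
    (i j : Fin m) :
    ∑ k ∈ Finset.univ.filter (fun k : Fin m => (k : ℕ) < r), P i j k ≤
      (if (i : ℕ) < r then 1 else 0) * (if (j : ℕ) < r then 1 else 0)
      + (1 - α) / 2 * ((if (i : ℕ) < r then 1 else 0) * (1 - (if (j : ℕ) < r then 1 else 0))
        + (1 - (if (i : ℕ) < r then 1 else 0)) * (if (j : ℕ) < r then 1 else 0)) := by
  obtain ⟨⟨h1, h2, h3⟩, h4, -⟩ := hV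
  -- the mixed case
  have key : ∀ i j : Fin m, (i : ℕ) < r → r ≤ (j : ℕ) →
      ∑ k ∈ Finset.univ.filter (fun k : Fin m => (k : ℕ) < r), P i j k ≤ (1 - α) / 2 := by
    intro i j hi hj
    rw [Finset.sum_eq_single i]
    · have h := hαmin i j hi hj
      have hne : j ≠ i := by rintro rfl; omega
      rw [aCoef, if_neg hne, h2 j i i] at h
      linarith
    · intro k hk hki
      have hk' : (k : ℕ) < r := by simpa using hk
      exact h4 i j k (by omega) hki (by rintro rfl; omega)
    · intro h
      exact absurd (by simpa using hi) h
  by_cases hi : (i : ℕ) < r <;> by_cases hj : (j : ℕ) < r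
  · simp only [hi, hj, if_true]
    have : ∑ k ∈ Finset.univ.filter (fun k : Fin m => (k : ℕ) < r), P i j k ≤ ∑ k, P i j k :=
      Finset.sum_le_sum_of_subset_of_nonneg (Finset.filter_subset _ _) fun k _ _ => h1 i j k
    rw [h3] at this
    linarith
  · simp only [hi, hj, if_true, if_false]
    have := key i j hi (by omega)
    linarith
  · simp only [hi, hj, if_true, if_false]
    have := key j i hj (by omega)
    simp only [h2 j i] at this
    linarith
  · simp only [hi, hj, if_false]
    rw [Finset.sum_eq_zero]
    · simp
    · intro k hk
      have hk' : (k : ℕ) < r := by simpa using hk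
      exact h4 i j k (by omega) (by rintro rfl; omega) (by rintro rfl; omega)

lemma phi_step {m ℓ r : ℕ} (hrℓ : r ≤ ℓ)
    {P : Fin m → Fin m → Fin m → ℝ} (hV : IsLVolterra m ℓ P) {α : ℝ}
    (hαmin : ∀ k i : Fin m, (k : ℕ) < r → r ≤ (i : ℕ) → α ≤ -aCoef m P k i)
    {x : Fin m → ℝ} (hx : InSimplex m x) :
    phiSum m r (QSOmap m P x) ≤ phiSum m r x * (1 - α + α * phiSum m r x) := by
  obtain ⟨hx0, hx1⟩ := hx
  set s : Fin m → ℝ := fun i => if (i : ℕ) < r then 1 else 0 with hs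
  have hphi : phiSum m r x = ∑ i, s i * x i := by
    simp [phiSum, hs, Finset.sum_filter]
  have hphi' : ∑ i, (1 - s i) * x i = 1 - phiSum m r x := by
    simp only [sub_mul, one_mul, Finset.sum_sub_distrib, hx1, hphi]
  have e1 : phiSum m r (QSOmap m P x) = ∑ i, ∑ j,
      (∑ k ∈ Finset.univ.filter (fun k : Fin m => (k : ℕ) < r), P i j k) * (x i * x j) := by
    unfold phiSum QSOmap
    rw [Finset.sum_comm]
    refine Finset.sum_congr rfl fun i _ => ?_
    rw [Finset.sum_comm]
    refine Finset.sum_congr rfl fun j _ => ?_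
    rw [Finset.sum_mul]
    exact Finset.sum_congr rfl fun k _ => by ring
  have e2 : phiSum m r (QSOmap m P x) ≤ ∑ i, ∑ j,
      (s i * s j + (1 - α) / 2 * (s i * (1 - s j) + (1 - s i) * s j)) * (x i * x j) := by
    rw [e1]
    exact Finset.sum_le_sum fun i _ => Finset.sum_le_sum fun j _ =>
      mul_le_mul_of_nonneg_right (coef_bound hrℓ hV hαmin i j) (mul_nonneg (hx0 i) (hx0 j))
  have e3 : ∑ i, ∑ j,
      (s i * s j + (1 - α) / 2 * (s i * (1 - s j) + (1 - s i) * s j)) * (x i * x j)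
      = (∑ i, s i * x i) * (∑ j, s j * x j)
        + (1 - α) / 2 * ((∑ i, s i * x i) * (∑ j, (1 - s j) * x j)
          + (∑ i, (1 - s i) * x i) * (∑ j, s j * x j)) := by
    simp only [Finset.sum_mul_sum]
    simp only [Finset.mul_sum, ← Finset.sum_add_distrib]
    exact Finset.sum_congr rfl fun i _ => Finset.sum_congr rfl fun j _ => by ring
  rw [e3, hphi', ← hphi] at e2
  linarith

/-- Theorem 6: for `i ∈ {1,...,r}` the coordinate `x_i^{(n)}` tends to 0 at
the rate of a geometric progression, with ratio `q = 1 - α + α φ(x^{(0)})`. -/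
theorem geometric_decay (m ℓ r : ℕ) (hℓ1 : 1 ≤ ℓ) (hℓm : ℓ ≤ m)
    (hr1 : 1 ≤ r) (hrℓ : r ≤ ℓ) (hrm : r < m)
    (P : Fin m → Fin m → Fin m → ℝ) (hV : IsLVolterra m ℓ P)
    (ha : ∀ k i : Fin m, (k : ℕ) < r → r ≤ (i : ℕ) → aCoef m P k i < 0)
    (α : ℝ)
    (hαmem : ∃ k i : Fin m, (k : ℕ) < r ∧ r ≤ (i : ℕ) ∧ α = -aCoef m P k i)
    (hαmin : ∀ k i : Fin m, (k : ℕ) < r → r ≤ (i : ℕ) → α ≤ -aCoef m P k i)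
    (traj : ℕ → (Fin m → ℝ)) (h0 : InIntSimplex m (traj 0))
    (hstep : ∀ n, traj (n + 1) = QSOmap m P (traj n))
    (i : Fin m) (hi : (i : ℕ) < r) :
    0 < 1 - α + α * phiSum m r (traj 0) ∧
    1 - α + α * phiSum m r (traj 0) < 1 ∧
    ∃ C : ℝ, 0 < C ∧
      ∀ n, traj n i ≤ C * (1 - α + α * phiSum m r (traj 0)) ^ n := by
  obtain ⟨k₀, i₀, hk₀, hi₀, hα⟩ := hαmem
  have hαpos : 0 < α := by have := ha k₀ i₀ hk₀ hi₀; linarith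
  have hα1 : α ≤ 1 := by
    have hne : i₀ ≠ k₀ := by rintro rfl; omega
    rw [hα, aCoef, if_neg hne]
    have := hV.1.1 i₀ k₀ k₀
    linarith
  have hsim : ∀ n, InSimplex m (traj n) := by
    intro n
    induction n with
    | zero => exact ⟨fun i => (h0.1 i).le, h0.2⟩
    | succ n ih => rw [hstep]; exact qso_simplex hV.1 ih
  have hle : ∀ n, traj n i ≤ phiSum m r (traj n) := fun n =>
    Finset.single_le_sum (f := traj n) (fun k _ => (hsim n).1 k) (by simpa using hi)
  have hφpos : 0 < phiSum m r (traj 0) := lt_of_lt_of_le (h0.1 i) (hle 0)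
  have hφlt : phiSum m r (traj 0) < 1 := by
    rw [← h0.2]
    refine Finset.sum_lt_sum_of_subset (i := i₀) (Finset.filter_subset _ _)
      (Finset.mem_univ _) (by simpa using hi₀) (h0.1 i₀) fun k _ _ => (h0.1 k).le
  have hq0 : 0 < 1 - α + α * phiSum m r (traj 0) := by
    have := mul_pos hαpos hφpos
    linarith
  have hq1 : 1 - α + α * phiSum m r (traj 0) < 1 := by
    have := mul_lt_mul_of_pos_left hφlt hαpos
    linarith
  refine ⟨hq0, hq1, phiSum m r (traj 0), hφpos, fun n => (hle n).trans ?_⟩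
  set q := 1 - α + α * phiSum m r (traj 0) with hq
  induction n with
  | zero => simp
  | succ n ih =>
    have h1 := phi_step hrℓ hV hαmin (hsim n)
    rw [← hstep] at h1
    have hn0 : 0 ≤ phiSum m r (traj n) := ((hsim n).1 i).trans (hle n)
    have hn1 : phiSum m r (traj n) ≤ phiSum m r (traj 0) :=
      ih.trans (mul_le_of_le_one_right hφpos.le (pow_le_one₀ hq0.le hq1.le))
    have h2 : 1 - α + α * phiSum m r (traj n) ≤ q := by
      have := mul_le_mul_of_nonneg_left hn1 hαpos.le
      linarith
    calc phiSum m r (traj (n + 1)) ≤ phiSum m r (traj n) * q :=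
          h1.trans (mul_le_mul_of_nonneg_left h2 hn0)
      _ ≤ phiSum m r (traj 0) * q ^ n * q := mul_le_mul_of_nonneg_right ih hq0.le
      _ = phiSum m r (traj 0) * q ^ (n + 1) := by ring
end
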